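/- arXiv:1911.10454 — 2 statements merged into one kernel-verified Lean document; each statement's English description precedes it below -/
import Mathlib

section
/- Let J : ℝ^d → (-∞, ∞] be proper, lower semicontinuous and bounded below, let h : ℝ^d → ℝ be differentiable with Lipschitz gradient, and let ρ > 0. Let (u_k)_{k≥0} be a bounded sequence in ℝ^d with ‖u_{k+1} − u_k‖ → 0 such that for every k, u_{k+1} is a global minimizer of u ↦ ⟨∇h(u_k), u − u_k⟩ + J(u) + (ρ/2)‖u − u_k‖². If a subsequence (u_{k_s}) converges to u*, then J(u_{k_s}) → J(u*) as s → ∞. -/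
open Filter
open scoped RealInnerProductSpace

theorem EReal.le_coe_sub_add_of_coe_add_le {a b : ℝ} {x y : EReal}
    (h : (a : EReal) + x ≤ (b : EReal) + y) : x ≤ ((b - a : ℝ) : EReal) + y := by
  have h' := add_le_add_right h ((-a : ℝ) : EReal)
  rwa [← add_assoc, ← add_assoc, ← EReal.coe_add, ← EReal.coe_add, neg_add_cancel,
    EReal.coe_zero, zero_add, neg_add_eq_sub] at h'

/-- Continuity of penalty values along proximal linearized block updates
(equation (eq:limu) in the proof of Lemma 5(i)): with `J` proper, lsc and
bounded below, `h` differentiable with Lipschitz gradient, and `u_{k+1}` a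
global minimizer of `u ↦ ⟨∇h(u_k), u − u_k⟩ + J(u) + (ρ/2)‖u − u_k‖²`, if the
bounded sequence `(u_k)` has vanishing successive gaps and a subsequence
`u_{k_s} → u*`, then `J(u_{k_s}) → J(u*)`. -/
theorem penalty_values_converge (d : ℕ)
    (J : EuclideanSpace ℝ (Fin d) → EReal)
    (hproper : ∃ q, J q ≠ ⊤)
    (hlsc : LowerSemicontinuous J)
    (hbdd : ∃ m : ℝ, ∀ q, (m : EReal) ≤ J q)
    (h : EuclideanSpace ℝ (Fin d) → ℝ)
    (g : EuclideanSpace ℝ (Fin d) → EuclideanSpace ℝ (Fin d))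
    (hgrad : ∀ x, HasGradientAt h (g x) x)
    (hlip : ∃ L : ℝ, 0 ≤ L ∧ ∀ x y, ‖g x - g y‖ ≤ L * ‖x - y‖)
    (ρ : ℝ) (hρ : 0 < ρ)
    (u : ℕ → EuclideanSpace ℝ (Fin d))
    (hubdd : ∃ M : ℝ, ∀ k, ‖u k‖ ≤ M)
    (hgap : Tendsto (fun k => ‖u (k + 1) - u k‖) atTop (nhds 0))
    (hmin : ∀ k, ∀ v : EuclideanSpace ℝ (Fin d),
      ((⟪g (u k), u (k + 1) - u k⟫ + ρ / 2 * ‖u (k + 1) - u k‖ ^ 2 : ℝ) : EReal)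
          + J (u (k + 1))
        ≤ ((⟪g (u k), v - u k⟫ + ρ / 2 * ‖v - u k‖ ^ 2 : ℝ) : EReal) + J v)
    (s : ℕ → ℕ) (hs : StrictMono s)
    (ustar : EuclideanSpace ℝ (Fin d))
    (hconv : Tendsto (fun j => u (s j)) atTop (nhds ustar)) :
    Tendsto (fun j => J (u (s j))) atTop (nhds (J ustar)) := by
  obtain ⟨L, hL, hlip⟩ := hlip
  have hgc : Continuous g :=
    (LipschitzWith.of_dist_le_mul (K := ⟨L, hL⟩) fun x y => by
      rw [dist_eq_norm, dist_eq_norm]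
      exact hlip x y).continuous
  have hs_top : Tendsto (fun j => s j - 1) atTop atTop :=
    (tendsto_sub_atTop_nat 1).comp hs.tendsto_atTop
  have hs_pos : ∀ᶠ j in atTop, s j - 1 + 1 = s j := by
    filter_upwards [hs.tendsto_atTop.eventually_ge_atTop 1] with j hj
    exact Nat.sub_add_cancel hj
  have hstep : Tendsto (fun j => u (s j) - u (s j - 1)) atTop (nhds 0) := by
    refine (tendsto_zero_iff_norm_tendsto_zero.2 (hgap.comp hs_top)).congr' ?_
    filter_upwards [hs_pos] with j hj
    simp only [hj]
  have hprev : Tendsto (fun j => u (s j - 1)) atTop (nhds ustar) := by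
    simpa using hconv.sub hstep
  have hgprev : Tendsto (fun j => g (u (s j - 1))) atTop (nhds (g ustar)) :=
    (hgc.tendsto ustar).comp hprev
  have hmodel : ∀ w : ℕ → EuclideanSpace ℝ (Fin d), Tendsto w atTop (nhds 0) →
      Tendsto (fun j => ⟪g (u (s j - 1)), w j⟫ + ρ / 2 * ‖w j‖ ^ 2) atTop (nhds 0) := by
    intro w hw
    simpa using (hgprev.inner hw).add ((hw.norm.pow 2).const_mul (ρ / 2))
  have hstar : Tendsto (fun j => ustar - u (s j - 1)) atTop (nhds 0) := by
    simpa using hprev.const_sub ustar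
  have hdiff := (hmodel _ hstar).sub (hmodel _ hstep)
  rw [sub_zero] at hdiff
  have hupper : Tendsto (fun j =>
      (((⟪g (u (s j - 1)), ustar - u (s j - 1)⟫ + ρ / 2 * ‖ustar - u (s j - 1)‖ ^ 2) -
        (⟪g (u (s j - 1)), u (s j) - u (s j - 1)⟫ +
          ρ / 2 * ‖u (s j) - u (s j - 1)‖ ^ 2) : ℝ) : EReal) + J ustar)
      atTop (nhds (J ustar)) := by
    have hadd := (EReal.continuousAt_add (p := (((0 : ℝ) : EReal), J ustar))
      (Or.inl (EReal.coe_ne_top 0)) (Or.inl (EReal.coe_ne_bot 0))).tendsto.comp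
      (((continuous_coe_real_ereal.tendsto 0).comp hdiff).prodMk_nhds
        (tendsto_const_nhds (x := J ustar)))
    simpa [Function.comp_def] using hadd
  refine tendsto_order.2 ⟨fun c hc => hconv.eventually (hlsc ustar c hc), fun c hc => ?_⟩
  filter_upwards [hupper.eventually_lt_const hc, hs_pos] with j hj hpos
  refine lt_of_le_of_lt ?_ hj
  have hm := hmin (s j - 1) ustar
  rw [hpos] at hm
  exact EReal.le_coe_sub_add_of_coe_add_le hm
end

section
/- Let I be a nonempty finite index set, Ω ⊆ I a nonempty subset, and let z*, z : I → ℝ, ε : Ω → ℝ, and nonnegative weights s : I × Ω → ℝ with ∑_{j∈Ω} s(i,j) = 1 for every i ∈ I. Set x_j = z*_j + ε_j for j ∈ Ω, and define F(w) = (1/|I|) ∑_{i∈I} ∑_{j∈Ω} s(i,j)(w_i − x_j)² for w : I → ℝ, and ρ = ( (1/|I|) ∑_{i∈I} (z_i − z*_i)² )^{1/2}. Assume there are nonnegative numbers b(i,j) with |z*_i − z*_j| ≤ b(i,j) for all i ∈ I, j ∈ Ω. Then F(z*) − F(z) ≤ 2ρ · max_{i∈I} ∑_{j∈Ω} s(i,j)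 b(i,j) + ρ · ( (1/|I|) ∑_{i∈I} ( ∑_{j∈Ω} 2 s(i,j) ε_j )² )^{1/2} − ρ². -/
/-- Cauchy–Schwarz inequality for finite sums scaled by a nonnegative constant. -/
theorem mul_sum_mul_le_sqrt_mul_sqrt {ι : Type*} (t : Finset ι) {c : ℝ} (hc : 0 ≤ c)
    (f g : ι → ℝ) :
    c * ∑ i ∈ t, f i * g i
      ≤ Real.sqrt (c * ∑ i ∈ t, f i ^ 2) * Real.sqrt (c * ∑ i ∈ t, g i ^ 2) := by
  rw [Real.sqrt_mul hc, Real.sqrt_mul hc, mul_mul_mul_comm, Real.mul_self_sqrt hc]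
  exact mul_le_mul_of_nonneg_left (Real.sum_mul_le_sqrt_mul_sqrt t f g) hc

/-- The root mean square of a function bounded by `C` in absolute value is at most `C`. -/
theorem sqrt_mean_sq_le {ι : Type*} [Fintype ι] [Nonempty ι] {f : ι → ℝ} {C : ℝ}
    (hf : ∀ i, |f i| ≤ C) :
    Real.sqrt ((1 / (Fintype.card ι : ℝ)) * ∑ i, f i ^ 2) ≤ C := by
  have hC : 0 ≤ C := (abs_nonneg _).trans (hf (Classical.arbitrary ι))
  have hn : (0 : ℝ) < Fintype.card ι := by exact_mod_cast Fintype.card_pos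
  have hsum : ∑ i, f i ^ 2 ≤ Fintype.card ι * C ^ 2 := by
    simpa using Finset.sum_le_card_nsmul Finset.univ (fun i => f i ^ 2) (C ^ 2)
      fun i _ => sq_le_sq' (neg_le_of_abs_le (hf i)) (le_of_abs_le (hf i))
  rw [Real.sqrt_le_left hC, one_div, inv_mul_le_iff₀ hn]
  exact hsum

/-- Difference of weighted quadratic losses at two points, for weights summing to one. -/
theorem sum_mul_sq_sub_sum_mul_sq {ι : Type*} (t : Finset ι) (p y e x : ι → ℝ)
    (hp : ∑ j ∈ t, p j = 1) (hx : ∀ j ∈ t, x j = y j + e j) (u v : ℝ) :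
    (∑ j ∈ t, p j * (u - x j) ^ 2) - ∑ j ∈ t, p j * (v - x j) ^ 2
      = (v - u) * (-2 * ∑ j ∈ t, p j * (u - y j)) + (v - u) * (∑ j ∈ t, 2 * p j * e j)
        - (v - u) ^ 2 := by
  rw [← mul_one ((v - u) ^ 2), ← hp]
  simp only [Finset.mul_sum]
  rw [← Finset.sum_sub_distrib, ← Finset.sum_add_distrib, ← Finset.sum_sub_distrib]
  refine Finset.sum_congr rfl fun j hj => ?_
  rw [hx j hj]
  ring


/-- Core deterministic inequality (equation (eq:sub22)) in the proof of
Theorem 2: for the ℓ₂-smoothing loss `F` with weights `s(i,j)` summing to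
one, observations `x_j = z*_j + ε_j`, and smoothness bounds
`|z*_i − z*_j| ≤ b(i,j)`, one has
`F(z*) − F(z) ≤ 2ρ·max_i ∑_j s(i,j) b(i,j)
  + ρ·((1/|I|)∑_i (∑_j 2 s(i,j) ε_j)²)^{1/2} − ρ²`. -/
theorem smoothing_loss_difference_bound
    {I : Type*} [Fintype I] [Nonempty I]
    (Ω : Finset I) (hΩ : Ω.Nonempty)
    (zstar z ε : I → ℝ)
    (s : I → I → ℝ)
    (hs_nonneg : ∀ i j, 0 ≤ s i j)
    (hs_sum : ∀ i, ∑ j ∈ Ω, s i j = 1)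
    (x : I → ℝ) (hx : ∀ j ∈ Ω, x j = zstar j + ε j)
    (F : (I → ℝ) → ℝ)
    (hF : ∀ w, F w = (1 / (Fintype.card I : ℝ)) *
      ∑ i, ∑ j ∈ Ω, s i j * (w i - x j) ^ 2)
    (ρ : ℝ)
    (hρ : ρ = Real.sqrt ((1 / (Fintype.card I : ℝ)) *
      ∑ i, (z i - zstar i) ^ 2))
    (b : I → I → ℝ)
    (hb_nonneg : ∀ i j, 0 ≤ b i j)
    (hb : ∀ i, ∀ j ∈ Ω, |zstar i - zstar j| ≤ b i j) :
    F zstar - F z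
      ≤ 2 * ρ * Finset.univ.sup' Finset.univ_nonempty
            (fun i : I => ∑ j ∈ Ω, s i j * b i j)
        + ρ * Real.sqrt ((1 / (Fintype.card I : ℝ)) *
            ∑ i, (∑ j ∈ Ω, 2 * s i j * ε j) ^ 2)
        - ρ ^ 2 := by
  set M := Finset.univ.sup' Finset.univ_nonempty (fun i : I => ∑ j ∈ Ω, s i j * b i j)
  set c : ℝ := 1 / (Fintype.card I : ℝ) with hc_def
  have hc : 0 ≤ c := by positivity
  have hρ_nonneg : 0 ≤ ρ := hρ ▸ Real.sqrt_nonneg _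
  have hρ_sq : ρ ^ 2 = c * ∑ i, (z i - zstar i) ^ 2 := by
    rw [hρ, Real.sq_sqrt (by positivity)]
  have hbias : ∀ i, |(-2) * ∑ j ∈ Ω, s i j * (zstar i - zstar j)| ≤ 2 * M := by
    intro i
    rw [abs_mul, abs_neg, abs_two]
    refine mul_le_mul_of_nonneg_left ?_ zero_le_two
    calc |∑ j ∈ Ω, s i j * (zstar i - zstar j)|
        ≤ ∑ j ∈ Ω, |s i j * (zstar i - zstar j)| := Finset.abs_sum_le_sum_abs _ _
      _ ≤ ∑ j ∈ Ω, s i j * b i j := by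
          refine Finset.sum_le_sum fun j hj => ?_
          rw [abs_mul, abs_of_nonneg (hs_nonneg i j)]
          exact mul_le_mul_of_nonneg_left (hb i j hj) (hs_nonneg i j)
      _ ≤ M := Finset.le_sup' (fun i : I => ∑ j ∈ Ω, s i j * b i j) (Finset.mem_univ i)
  have hexpand : F zstar - F z
      = c * ∑ i, (z i - zstar i) * (-2 * ∑ j ∈ Ω, s i j * (zstar i - zstar j))
        + c * ∑ i, (z i - zstar i) * (∑ j ∈ Ω, 2 * s i j * ε j) - ρ ^ 2 := by
    rw [hF, hF, hρ_sq, ← mul_sub, ← mul_add, ← mul_sub, ← Finset.sum_sub_distrib,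
      ← Finset.sum_add_distrib, ← Finset.sum_sub_distrib]
    congr 1
    exact Finset.sum_congr rfl fun i _ =>
      sum_mul_sq_sub_sum_mul_sq Ω (s i) zstar ε x (hs_sum i) hx (zstar i) (z i)
  have hfirst := mul_sum_mul_le_sqrt_mul_sqrt Finset.univ hc (fun i => z i - zstar i)
    (fun i => -2 * ∑ j ∈ Ω, s i j * (zstar i - zstar j))
  have hnoise := mul_sum_mul_le_sqrt_mul_sqrt Finset.univ hc (fun i => z i - zstar i)
    (fun i => ∑ j ∈ Ω, 2 * s i j * ε j)
  rw [← hρ] at hfirst hnoise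
  have hbias_le := mul_le_mul_of_nonneg_left (sqrt_mean_sq_le hbias) hρ_nonneg
  rw [← hc_def] at hbias_le
  rw [hexpand]
  linarith
end
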